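/- arXiv:2412.09965 — 4 statements merged into one kernel-verified Lean document; each statement's English description precedes it below -/
import Mathlib

section
/- Let A ∈ ℝ^{5×5} be any matrix such that A(1,5), A(2,5), A(3,5), A(4,1), A(4,5), A(5,1), A(5,2), A(5,3), and A(5,4) are all nonzero and all other entries of A are zero, and let C ∈ ℝ^{3×5} be any matrix such that C(1,1), C(2,2), C(3,3) are nonzero and all other entries of C are zero. Then the pair (A, C) is observable. -/
open Matrix

/-- A pair `(A, C)` is observable if the only vector `v` with `C * A^k * v = 0`
for all natural numbers `k` is `v = 0`. -/
def Observable {N p : ℕ} (A : Matrix (Fin N) (Fin N) ℝ) (C : Matrix (Fin p) (Fin N) ℝ) : Prop :=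
  ∀ v : Fin N → ℝ, (∀ k : ℕ, C *ᵥ ((A ^ k) *ᵥ v) = 0) → v = 0

/-- Strong structural observability of the modified star network with sensors at
nodes 1, 2 and 3. -/
theorem star_network_sensors_123_observable
    (A : Matrix (Fin 5) (Fin 5) ℝ) (C : Matrix (Fin 3) (Fin 5) ℝ)
    (hA : ∀ i j : Fin 5, A i j ≠ 0 ↔
      (i, j) ∈ ({(0,4), (1,4), (2,4), (3,0), (3,4), (4,0), (4,1), (4,2), (4,3)} :
        Set (Fin 5 × Fin 5)))
    (hC : ∀ i j, C i j ≠ 0 ↔ (i, j) ∈ ({(0,0), (1,1), (2,2)} : Set (Fin 3 × Fin 5))) :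
    Observable A C := by
  have row (i : Fin 3) (j : Fin 5) (hj : C i j ≠ 0) (h0 : ∀ l, l ≠ j → C i l = 0)
      (w : Fin 5 → ℝ) (hw : C *ᵥ w = 0) : w j = 0 := by
    have h := congrFun hw i
    rw [Matrix.mulVec, dotProduct, Finset.sum_eq_single j
      (fun l _ hl => by rw [h0 l hl, zero_mul]) (by simp)] at h
    exact (mul_eq_zero.mp h).resolve_left hj
  have zeroC (i : Fin 3) (j : Fin 5)
      (h : (i, j) ∉ ({(0,0), (1,1), (2,2)} : Set (Fin 3 × Fin 5))) : C i j = 0 :=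
    not_not.mp (mt (hC i j).mp h)
  have zeroA (j : Fin 5) (hj : j ≠ 4) : A 0 j = 0 := by
    by_contra h
    have := (hA 0 j).mp h
    fin_cases j <;> simp_all
  have sense (w : Fin 5 → ℝ) (hw : C *ᵥ w = 0) : w 0 = 0 ∧ w 1 = 0 ∧ w 2 = 0 := by
    refine ⟨row 0 0 ?_ ?_ w hw, row 1 1 ?_ ?_ w hw, row 2 2 ?_ ?_ w hw⟩
    all_goals first
      | exact (hC _ _).mpr (by simp)
      | exact fun l hl => zeroC _ l (by simpa using hl)
  have step (w : Fin 5 → ℝ) (hw : (A *ᵥ w) 0 = 0) : w 4 = 0 := by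
    rw [Matrix.mulVec, dotProduct, Finset.sum_eq_single 4
      (fun l _ hl => by rw [zeroA l hl, zero_mul]) (by simp)] at hw
    exact (mul_eq_zero.mp hw).resolve_left ((hA 0 4).mpr (by simp))
  intro v hv
  obtain ⟨h0, h1, h2⟩ := sense v (by simpa using hv 0)
  have h4 : v 4 = 0 := step v (sense _ (by simpa using hv 1)).1
  have hAv : (A *ᵥ v) 4 = 0 := by
    refine step _ (sense _ ?_).1
    simpa [pow_two] using hv 2
  have h3 : v 3 = 0 := by
    simp only [Matrix.mulVec, dotProduct, Fin.sum_univ_five, h0, h1, h2, h4, mul_zero,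
      zero_add, add_zero] at hAv
    exact (mul_eq_zero.mp hAv).resolve_left ((hA 4 3).mpr (by simp))
  ext j
  fin_cases j <;> assumption
end

section
/- Let A ∈ ℝ^{5×5} be any matrix such that A(1,5), A(2,5), A(3,5), A(4,1), A(4,5), A(5,1), A(5,2), A(5,3), and A(5,4) are all nonzero and all other entries of A are zero, and let C ∈ ℝ^{3×5} be any matrix such that C(1,2), C(2,3), C(3,4) are nonzero and all other entries of C are zero. Then the pair (A, C) is observable. -/
open Matrix

/-- Strong structural observability of the modified star network with sensors at
nodes 2, 3 and 4. -/
theorem star_network_sensors_234_observable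
    (A : Matrix (Fin 5) (Fin 5) ℝ) (C : Matrix (Fin 3) (Fin 5) ℝ)
    (hA : ∀ i j : Fin 5, A i j ≠ 0 ↔
      (i, j) ∈ ({(0,4), (1,4), (2,4), (3,0), (3,4), (4,0), (4,1), (4,2), (4,3)} :
        Set (Fin 5 × Fin 5)))
    (hC : ∀ i j, C i j ≠ 0 ↔ (i, j) ∈ ({(0,1), (1,2), (2,3)} : Set (Fin 3 × Fin 5))) :
    Observable A C := by
  have zC (i j) (h : (i, j) ∉ ({(0,1), (1,2), (2,3)} : Set (Fin 3 × Fin 5))) : C i j = 0 :=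
    not_not.1 fun hne => h ((hC i j).1 hne)
  have zA (i j) (h : (i, j) ∉ ({(0,4), (1,4), (2,4), (3,0), (3,4), (4,0), (4,1), (4,2), (4,3)} :
      Set (Fin 5 × Fin 5))) : A i j = 0 :=
    not_not.1 fun hne => h ((hA i j).1 hne)
  have sensors (w : Fin 5 → ℝ) (hw : C *ᵥ w = 0) : w 1 = 0 ∧ w 2 = 0 ∧ w 3 = 0 := by
    have c01 : C 0 1 ≠ 0 := (hC 0 1).2 (by simp)
    have c12 : C 1 2 ≠ 0 := (hC 1 2).2 (by simp)
    have c23 : C 2 3 ≠ 0 := (hC 2 3).2 (by simp)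
    have h0 := congrFun hw 0
    have h1 := congrFun hw 1
    have h2 := congrFun hw 2
    simp [mulVec, dotProduct, Fin.sum_univ_five, zC, c01] at h0
    simp [mulVec, dotProduct, Fin.sum_univ_five, zC, c12] at h1
    simp [mulVec, dotProduct, Fin.sum_univ_five, zC, c23] at h2
    exact ⟨h0, h1, h2⟩
  intro v hv
  obtain ⟨v1, v2, v3⟩ := sensors v (by simpa using hv 0)
  obtain ⟨h1, -, h3⟩ := sensors (A *ᵥ v) (by simpa using hv 1)
  have a14 : A 1 4 ≠ 0 := (hA 1 4).2 (by simp)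
  have a30 : A 3 0 ≠ 0 := (hA 3 0).2 (by simp)
  have v4 : v 4 = 0 := by
    simpa [mulVec, dotProduct, Fin.sum_univ_five, zA, a14] using h1
  have v0 : v 0 = 0 := by
    simpa [mulVec, dotProduct, Fin.sum_univ_five, v1, v2, v3, v4, a30] using h3
  ext i
  fin_cases i <;> assumption
end

section
/- Let A ∈ ℝ^{8×8} be any matrix satisfying: A(i,i) ≠ 0 for i = 1,2,3,4; A(1,5), A(1,8), A(2,5), A(2,7), A(3,5), A(3,6), A(4,6), A(4,7), A(5,1), A(5,2), A(5,3), A(6,3), A(6,4), A(7,2), A(7,4), A(8,1) are all nonzero; the diagonal entries A(5,5), A(6,6), A(7,7), A(8,8) are arbitrary real numbers; and all remaining entries of A are zero. Let C ∈ ℝ^{2×8} be any matrix with C(1,4) ≠ 0, C(2,6) ≠ 0 and all other entries zero. Then the pair (A, C) is observable. -/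
open Matrix

/-- The set of positions where the pattern matrix 𝒜_WDN of the triangular WDN has a ∗,
i.e. where every matrix in its pattern class must be nonzero (0-based indexing). -/
def starPositions : Set (Fin 8 × Fin 8) :=
  {(0,0), (1,1), (2,2), (3,3),
   (0,4), (0,7), (1,4), (1,6), (2,4), (2,5), (3,5), (3,6),
   (4,0), (4,1), (4,2), (5,2), (5,3), (6,1), (6,3), (7,0)}

/-- The set of positions where 𝒜_WDN has a ?, i.e. where the entries are arbitrary. -/
def questionPositions : Set (Fin 8 × Fin 8) :=
  {(4,4), (5,5), (6,6), (7,7)}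

/-- If coordinate `i` vanishes along the whole orbit of `v` under `A`, and so does every coordinate
`j ≠ l` with `A i j ≠ 0`, then coordinate `l` vanishes along the orbit as soon as `A i l ≠ 0`. -/
theorem pow_mulVec_eq_zero_of_forces {n : Type*} [Fintype n] [DecidableEq n] {A : Matrix n n ℝ}
    {v : n → ℝ} {i l : n} (hil : A i l ≠ 0) (hi : ∀ k : ℕ, (A ^ k *ᵥ v) i = 0)
    (hother : ∀ j, j ≠ l → A i j = 0 ∨ ∀ k : ℕ, (A ^ k *ᵥ v) j = 0) (k : ℕ) :
    (A ^ k *ᵥ v) l = 0 := by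
  have h := hi (k + 1)
  rw [pow_succ', ← mulVec_mulVec, mulVec, dotProduct, Finset.sum_eq_single l] at h
  · exact (mul_eq_zero.mp h).resolve_left hil
  · intro j _ hj
    rcases hother j hj with h0 | h0 <;> simp [h0]
  · simp

set_option maxHeartbeats 800000 in
theorem wdn_observable
    (A : Matrix (Fin 8) (Fin 8) ℝ) (C : Matrix (Fin 2) (Fin 8) ℝ)
    (hAstar : ∀ i j : Fin 8, (i, j) ∈ starPositions → A i j ≠ 0)
    (hAzero : ∀ i j : Fin 8, (i, j) ∉ starPositions ∪ questionPositions → A i j = 0)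
    (hC : ∀ i j, C i j ≠ 0 ↔ (i, j) ∈ ({(0,3), (1,5)} : Set (Fin 2 × Fin 8))) :
    Observable A C := by
  intro v hv
  have hC03 : C 0 3 ≠ 0 := (hC 0 3).mpr (by simp)
  have hC15 : C 1 5 ≠ 0 := (hC 1 5).mpr (by simp)
  have hCzero (i : Fin 2) (j : Fin 8) (h : (i, j) ∉ ({(0,3), (1,5)} : Set (Fin 2 × Fin 8))) :
      C i j = 0 := by
    by_contra h0
    exact h ((hC i j).mp h0)
  have measured (i : Fin 2) (l : Fin 8) (hil : C i l ≠ 0) (hi : ∀ j, j ≠ l → C i j = 0) (k : ℕ) :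
      (A ^ k *ᵥ v) l = 0 := by
    have h := congrFun (hv k) i
    rw [mulVec, dotProduct, Finset.sum_eq_single l] at h
    · exact (mul_eq_zero.mp h).resolve_left hil
    · intro j _ hj
      simp [hi j hj]
    · simp
  have h3 := measured 0 3 hC03 (fun j hj => hCzero 0 j (by simp [hj]))
  have h5 := measured 1 5 hC15 (fun j hj => hCzero 1 j (by simp [hj]))
  have h6 := pow_mulVec_eq_zero_of_forces (hAstar 3 6 (by simp [starPositions])) h3 (by
    intro j hj
    fin_cases j <;> first
      | exact absurd rfl hj
      | exact Or.inr h3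
      | exact Or.inr h5
      | exact Or.inl (hAzero _ _ (by simp [starPositions, questionPositions])))
  have h2 := pow_mulVec_eq_zero_of_forces (hAstar 5 2 (by simp [starPositions])) h5 (by
    intro j hj
    fin_cases j <;> first
      | exact absurd rfl hj
      | exact Or.inr h3
      | exact Or.inr h5
      | exact Or.inl (hAzero _ _ (by simp [starPositions, questionPositions])))
  have h1 := pow_mulVec_eq_zero_of_forces (hAstar 6 1 (by simp [starPositions])) h6 (by
    intro j hj
    fin_cases j <;> first
      | exact absurd rfl hj
      | exact Or.inr h3
      | exact Or.inr h6
      | exact Or.inl (hAzero _ _ (by simp [starPositions, questionPositions])))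
  have h4 := pow_mulVec_eq_zero_of_forces (hAstar 2 4 (by simp [starPositions])) h2 (by
    intro j hj
    fin_cases j <;> first
      | exact absurd rfl hj
      | exact Or.inr h2
      | exact Or.inr h5
      | exact Or.inl (hAzero _ _ (by simp [starPositions, questionPositions])))
  have h0 := pow_mulVec_eq_zero_of_forces (hAstar 4 0 (by simp [starPositions])) h4 (by
    intro j hj
    fin_cases j <;> first
      | exact absurd rfl hj
      | exact Or.inr h1
      | exact Or.inr h2
      | exact Or.inr h4
      | exact Or.inl (hAzero _ _ (by simp [starPositions, questionPositions])))
  have h7 := pow_mulVec_eq_zero_of_forces (hAstar 0 7 (by simp [starPositions])) h0 (by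
    intro j hj
    fin_cases j <;> first
      | exact absurd rfl hj
      | exact Or.inr h0
      | exact Or.inr h4
      | exact Or.inl (hAzero _ _ (by simp [starPositions, questionPositions])))
  funext j
  have hj : ∀ k : ℕ, (A ^ k *ᵥ v) j = 0 := by
    fin_cases j
    exacts [h0, h1, h2, h3, h4, h5, h6, h7]
  simpa using hj 0
end

section
/- Let A ∈ ℝ^{3×3} be any matrix such that A(1,2), A(1,3), A(2,1), A(2,2), A(3,1), A(3,3) are all nonzero, A(1,1) = 0, A(3,2) = 0, and A(2,3) is an arbitrary real number. Let C ∈ ℝ^{2×3} be any matrix with C(1,1) ≠ 0, C(1,3) ≠ 0, C(2,3) ≠ 0 and all other entries zero. Then the pair (A, C) is observable. -/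
open Matrix

/-- Strong structural observability of the pattern matrices of Example 1 of the paper,
with the adjusted sensor pattern.  Entry A(2,3) (1-based) is a `?`-entry: it is
unconstrained. -/
theorem example1_adjusted_observable
    (A : Matrix (Fin 3) (Fin 3) ℝ) (C : Matrix (Fin 2) (Fin 3) ℝ)
    (hAstar : ∀ i j : Fin 3,
      (i, j) ∈ ({(0,1), (0,2), (1,0), (1,1), (2,0), (2,2)} : Set (Fin 3 × Fin 3)) →
        A i j ≠ 0)
    (hAzero : A 0 0 = 0) (hAzero' : A 2 1 = 0)
    (hC : ∀ i j, C i j ≠ 0 ↔ (i, j) ∈ ({(0,0), (0,2), (1,2)} : Set (Fin 2 × Fin 3))) :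
    Observable A C := by
  have entry_eq_zero (w : Fin 3 → ℝ) (hw : C *ᵥ w = 0) : w 0 = 0 ∧ w 2 = 0 := by
    have h00 : C 0 0 ≠ 0 := by simp [hC]
    have h12 : C 1 2 ≠ 0 := by simp [hC]
    have h01 : C 0 1 = 0 := by by_contra h; simp [hC] at h
    have h10 : C 1 0 = 0 := by by_contra h; simp [hC] at h
    have h11 : C 1 1 = 0 := by by_contra h; simp [hC] at h
    have row0 := congrFun hw 0
    have row1 := congrFun hw 1
    simp only [mulVec, dotProduct, Fin.sum_univ_three, Pi.zero_apply, h01, h10, h11, zero_mul,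
      zero_add, add_zero] at row0 row1
    have hw2 : w 2 = 0 := (mul_eq_zero.mp row1).resolve_left h12
    rw [hw2, mul_zero, add_zero] at row0
    exact ⟨(mul_eq_zero.mp row0).resolve_left h00, hw2⟩
  intro v hv
  obtain ⟨hv0, hv2⟩ := entry_eq_zero v (by simpa using hv 0)
  have hAv := (entry_eq_zero (A *ᵥ v) (by simpa using hv 1)).1
  simp only [mulVec, dotProduct, Fin.sum_univ_three, hv0, hv2, mul_zero, zero_add,
    add_zero] at hAv
  have hv1 : v 1 = 0 := (mul_eq_zero.mp hAv).resolve_left (hAstar 0 1 (by simp))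
  ext i
  fin_cases i <;> assumption
end
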